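/- arXiv:2110.07519 — 7 statements merged into one kernel-verified Lean document; each statement's English description precedes it below -/
import Mathlib

section
/- Let n ≥ 1, let q, c : Fin n → ℝ be series, let r : ℕ be a warping reach. Then LB_Keogh_r(q,c) ≤ DTW_r(q,c), i.e., the LB_Keogh measure computed from the envelope of q with reach r lower bounds the constrained Dynamic Time Warping distance between q and c with the same reach. -/
def bandSet (n r : ℕ) (i : Fin n) : Finset (Fin n) :=
  Finset.univ.filter (fun j => |((i : ℕ) : ℤ) - ((j : ℕ) : ℤ)| ≤ (r : ℤ))

lemma bandSet_nonempty (n r : ℕ) (i : Fin n) : (bandSet n r i).Nonempty :=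
  ⟨i, by simp [bandSet]⟩

/-- Upper LB_Keogh envelope of `q` with reach `r`. -/
noncomputable def envU {n : ℕ} (q : Fin n → ℝ) (r : ℕ) : Fin n → ℝ :=
  fun i => (bandSet n r i).sup' (bandSet_nonempty n r i) q

/-- Lower LB_Keogh envelope of `q` with reach `r`. -/
noncomputable def envL {n : ℕ} (q : Fin n → ℝ) (r : ℕ) : Fin n → ℝ :=
  fun i => (bandSet n r i).inf' (bandSet_nonempty n r i) q

/-- The LB_Keogh lower-bounding measure of candidate `c` w.r.t. the envelope of `q` with reach `r`. -/
noncomputable def LBKeogh {n : ℕ} (q c : Fin n → ℝ) (r : ℕ) : ℝ :=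
  Real.sqrt (∑ i, if envU q r i < c i then (c i - envU q r i) ^ 2
    else if c i < envL q r i then (c i - envL q r i) ^ 2 else 0)

/-- A constrained warping path between two series of length `n`, with band reach `r`. -/
structure WarpingPath (n r : ℕ) where
  K : ℕ
  p : Fin (K + 1) → ℕ × ℕ
  mem1 : ∀ k, (p k).1 < n
  mem2 : ∀ k, (p k).2 < n
  start : p 0 = (0, 0)
  finish : p (Fin.last K) = (n - 1, n - 1)
  step : ∀ k : Fin K,
    p k.succ = ((p k.castSucc).1 + 1, (p k.castSucc).2) ∨
    p k.succ = ((p k.castSucc).1, (p k.castSucc).2 + 1) ∨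
    p k.succ = ((p k.castSucc).1 + 1, (p k.castSucc).2 + 1)
  band : ∀ k, |(((p k).1 : ℤ)) - (((p k).2 : ℤ))| ≤ (r : ℤ)

/-- The cost of a warping path. -/
noncomputable def dtwCost {n r : ℕ} (q c : Fin n → ℝ) (P : WarpingPath n r) : ℝ :=
  Real.sqrt (∑ k : Fin (P.K + 1),
    (q ⟨(P.p k).1, P.mem1 k⟩ - c ⟨(P.p k).2, P.mem2 k⟩) ^ 2)

/-- The constrained DTW distance with reach `r`: minimal cost over all warping paths. -/
noncomputable def DTW (n r : ℕ) (q c : Fin n → ℝ) : ℝ :=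
  sInf { x : ℝ | ∃ P : WarpingPath n r, x = dtwCost q c P }

lemma WarpingPath.surj_aux {n r : ℕ} (P : WarpingPath n r) (k : Fin (P.K + 1)) :
    ∀ m ≤ (P.p k).2, ∃ k', (P.p k').2 = m := by
  induction k using Fin.induction with
  | zero =>
    intro m hm
    refine ⟨0, ?_⟩
    rw [P.start] at hm ⊢
    simp at hm ⊢
    omega
  | succ k ih =>
    intro m hm
    by_cases h : m ≤ (P.p k.castSucc).2
    · exact ih m h
    · refine ⟨k.succ, ?_⟩
      rcases P.step k with h1 | h1 | h1 <;> rw [h1] at hm ⊢ <;> simp at hm ⊢ <;> omega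

lemma term_le {n : ℕ} (q c : Fin n → ℝ) (r : ℕ) (i j : Fin n)
    (h : |((i : ℕ) : ℤ) - ((j : ℕ) : ℤ)| ≤ (r : ℤ)) :
    (if envU q r j < c j then (c j - envU q r j) ^ 2
    else if c j < envL q r j then (c j - envL q r j) ^ 2 else 0) ≤ (q i - c j) ^ 2 := by
  have hm : i ∈ bandSet n r j := by
    simp only [bandSet, Finset.mem_filter, Finset.mem_univ, true_and]
    rwa [abs_sub_comm]
  have h1 : q i ≤ envU q r j := Finset.le_sup' q hm
  have h2 : envL q r j ≤ q i := Finset.inf'_le q hm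
  split_ifs with a b
  · nlinarith
  · nlinarith
  · positivity

lemma LBKeogh_le_cost {n r : ℕ} (q c : Fin n → ℝ) (P : WarpingPath n r) :
    LBKeogh q c r ≤ dtwCost q c P := by
  have hs : ∀ j : Fin n, ∃ k, (P.p k).2 = j := fun j =>
    P.surj_aux (Fin.last P.K) j (by rw [P.finish]; have := j.2; simp; omega)
  choose f hf using hs
  have hinj : Function.Injective f := fun a b hab => by
    apply Fin.ext
    rw [← hf a, ← hf b, hab]
  unfold LBKeogh dtwCost
  apply Real.sqrt_le_sqrt
  calc _ ≤ ∑ j : Fin n, (q ⟨(P.p (f j)).1, P.mem1 _⟩ - c ⟨(P.p (f j)).2, P.mem2 _⟩) ^ 2 := by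
        apply Finset.sum_le_sum
        intro j _
        have e : (⟨(P.p (f j)).2, P.mem2 _⟩ : Fin n) = j := Fin.ext (hf j)
        rw [e]
        apply term_le
        have := P.band (f j)
        rwa [hf j] at this
    _ = ∑ k ∈ Finset.univ.image f,
          (q ⟨(P.p k).1, P.mem1 k⟩ - c ⟨(P.p k).2, P.mem2 k⟩) ^ 2 := by
        rw [Finset.sum_image (fun a _ b _ hab => hinj hab)]
    _ ≤ _ := Finset.sum_le_sum_of_subset_of_nonneg (Finset.subset_univ _)
        (fun _ _ _ => sq_nonneg _)

def diagPath (n r : ℕ) (hn : 1 ≤ n) : WarpingPath n r where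
  K := n - 1
  p := fun k => (k, k)
  mem1 := fun k => by have := k.2; simp only; omega
  mem2 := fun k => by have := k.2; simp only; omega
  start := by simp
  finish := by simp
  step := fun k => by right; right; simp
  band := fun k => by simp

theorem stmt2 (n : ℕ) (hn : 1 ≤ n) (q c : Fin n → ℝ) (r : ℕ) :
    LBKeogh q c r ≤ DTW n r q c := by
  unfold DTW
  apply le_csInf
  · exact ⟨_, diagPath n r hn, rfl⟩
  · rintro x ⟨P, rfl⟩
    exact LBKeogh_le_cost q c P
end

section
/- Let w, m ≥ 1, n = w·m, and let q, c : Fin n → ℝ be series. Then sqrt(Σ_{s : Fin w} m · (PAA(q) s − PAA(c) s)²) ≤ ED(q,c): the scaled Euclidean distance between the PAA representations lower bounds the Euclidean distance between the raw series. -/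
/-- The Euclidean distance between two series. -/
noncomputable def ED {n : ℕ} (q c : Fin n → ℝ) : ℝ :=
  Real.sqrt (∑ i, (q i - c i) ^ 2)

/-- The PAA representation: the vector of the `w` segment means of a series of length `w * m`. -/
noncomputable def PAA (w m : ℕ) (q : Fin (w * m) → ℝ) : Fin w → ℝ :=
  fun s => (1 / (m : ℝ)) * ∑ t : Fin m, q ⟨(s : ℕ) * m + (t : ℕ), by
    calc (s : ℕ) * m + (t : ℕ) < (s : ℕ) * m + m := Nat.add_lt_add_left t.isLt _
      _ = ((s : ℕ) + 1) * m := by ring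
      _ ≤ w * m := Nat.mul_le_mul s.isLt (le_refl m)⟩

theorem stmt7 (w m : ℕ) (hw : 1 ≤ w) (hm : 1 ≤ m) (q c : Fin (w * m) → ℝ) :
    Real.sqrt (∑ s : Fin w, (m : ℝ) * (PAA w m q s - PAA w m c s) ^ 2) ≤ ED q c := by
  unfold ED
  apply Real.sqrt_le_sqrt
  have hm0 : (0 : ℝ) < m := by exact_mod_cast hm
  rw [← finProdFinEquiv.sum_comp, Fintype.sum_prod_type]
  apply Finset.sum_le_sum
  intro s _
  have key : PAA w m q s - PAA w m c s = (1 / (m : ℝ)) *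
      ∑ t : Fin m, (q (finProdFinEquiv (s, t)) - c (finProdFinEquiv (s, t))) := by
    unfold PAA
    rw [← mul_sub, ← Finset.sum_sub_distrib]
    congr 1
    apply Finset.sum_congr rfl
    intro t _
    have h : ∀ h, (⟨(s : ℕ) * m + (t : ℕ), h⟩ : Fin (w * m)) = finProdFinEquiv (s, t) := by
      intro h
      apply Fin.ext
      simp only [finProdFinEquiv_apply_val]
      ring
    rw [h]
  rw [key]
  have cs := sq_sum_le_card_mul_sum_sq (s := (Finset.univ : Finset (Fin m)))
    (f := fun t => q (finProdFinEquiv (s, t)) - c (finProdFinEquiv (s, t)))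
  simp only [Finset.card_univ, Fintype.card_fin] at cs
  rw [mul_pow, ← mul_assoc, show (m : ℝ) * (1 / (m : ℝ)) ^ 2 = (m : ℝ)⁻¹ by field_simp,
    inv_mul_le_iff₀ hm0]
  exact cs
end

section
/- (Lower-bounding property of the iSAX node summary.) Let w, m ≥ 1, n = w·m, let q, c : Fin n → ℝ be series, and let l, u : Fin w → ℝ with l s ≤ u s for every segment s. If c is contained in the node, i.e., l s ≤ PAA(c) s ≤ u s for every s, then mindist(q, node) ≤ ED(q,c): the distance between the query and the node's iSAX summary lower bounds the real Euclidean distance between the query and any series contained in the node. -/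
/-- The mindist of a query `q` to an iSAX node with segment intervals `[l s, u s]`. -/
noncomputable def mindist (w m : ℕ) (q : Fin (w * m) → ℝ) (l u : Fin w → ℝ) : ℝ :=
  Real.sqrt (∑ s : Fin w, (m : ℝ) *
    (if PAA w m q s < l s then (l s - PAA w m q s) ^ 2
     else if u s < PAA w m q s then (PAA w m q s - u s) ^ 2 else 0))

theorem stmt9 (w m : ℕ) (hw : 1 ≤ w) (hm : 1 ≤ m) (q c : Fin (w * m) → ℝ)
    (l u : Fin w → ℝ) (hlu : ∀ s, l s ≤ u s)
    (hc : ∀ s, l s ≤ PAA w m c s ∧ PAA w m c s ≤ u s) :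
    mindist w m q l u ≤ ED q c := by
  unfold mindist ED
  apply Real.sqrt_le_sqrt
  have hm0 : (0 : ℝ) < m := by exact_mod_cast hm
  rw [← finProdFinEquiv.sum_comp, Fintype.sum_prod_type]
  apply Finset.sum_le_sum
  intro s _
  have key : (m : ℝ) * (PAA w m q s - PAA w m c s) ^ 2 ≤
      ∑ t : Fin m, (q (finProdFinEquiv (s, t)) - c (finProdFinEquiv (s, t))) ^ 2 := by
    have hP : ∀ x : Fin (w * m) → ℝ,
        PAA w m x s = (1 / (m : ℝ)) * ∑ t : Fin m, x (finProdFinEquiv (s, t)) := by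
      intro x
      unfold PAA
      congr 1
      apply Finset.sum_congr rfl
      intro t _
      congr 1
      apply Fin.ext
      simp [finProdFinEquiv]
      ring
    rw [hP, hP, ← mul_sub, ← Finset.sum_sub_distrib]
    have h := sq_sum_le_card_mul_sum_sq (s := (Finset.univ : Finset (Fin m)))
      (f := fun t => q (finProdFinEquiv (s, t)) - c (finProdFinEquiv (s, t)))
    rw [Finset.card_univ, Fintype.card_fin] at h
    rw [mul_pow, ← mul_assoc]
    have e : (m : ℝ) * (1 / (m : ℝ)) ^ 2 = 1 / m := by field_simp
    rw [e, one_div, inv_mul_le_iff₀ hm0]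
    exact h
  refine le_trans (mul_le_mul_of_nonneg_left ?_ hm0.le) key
  obtain ⟨h1, h2⟩ := hc s
  split_ifs with ha hb
  · nlinarith
  · nlinarith
  · positivity
end

section
/- (Pruning soundness of the iSAX lower bound.) Let w, m ≥ 1, n = w·m, let q : Fin n → ℝ be a query, let N' be a finite set of series each contained in an iSAX node with intervals l', u' : Fin w → ℝ (l' s ≤ u' s and l' s ≤ PAA(c) s ≤ u' s for all c ∈ N' and all s), and let d ∈ ℝ. If d < mindist(q, node'), then ED(q,c) > d for every c ∈ N': if some already-found real distance d is smaller than the lower bound distance of the query to a node, then all real distances between the query and the series in that node are greater than d. -/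
theorem stmt10 (w m : ℕ) (hw : 1 ≤ w) (hm : 1 ≤ m) (q : Fin (w * m) → ℝ)
    (N' : Finset (Fin (w * m) → ℝ)) (l' u' : Fin w → ℝ)
    (hlu : ∀ s, l' s ≤ u' s)
    (hc : ∀ c ∈ N', ∀ s, l' s ≤ PAA w m c s ∧ PAA w m c s ≤ u' s)
    (d : ℝ) (hd : d < mindist w m q l' u') :
    ∀ c ∈ N', d < ED q c := by
  intro c hcN
  refine lt_of_lt_of_le hd ?_
  unfold mindist ED
  apply Real.sqrt_le_sqrt
  have hm0 : (0 : ℝ) < m := by exact_mod_cast hm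
  rw [← (finProdFinEquiv (m := w) (n := m)).sum_comp, Fintype.sum_prod_type]
  refine Finset.sum_le_sum fun s _ => ?_
  obtain ⟨h1, h2⟩ := hc c hcN s
  set f : Fin m → ℝ := fun t => q (finProdFinEquiv (s, t)) - c (finProdFinEquiv (s, t)) with hf
  have key : (m : ℝ) * (PAA w m q s - PAA w m c s) = ∑ t, f t := by
    unfold PAA
    rw [← mul_sub, ← mul_assoc, mul_one_div_cancel hm0.ne', one_mul, ← Finset.sum_sub_distrib]
    refine Finset.sum_congr rfl fun t _ => ?_
    have e : ∀ h, (⟨(s : ℕ) * m + (t : ℕ), h⟩ : Fin (w * m)) = finProdFinEquiv (s, t) := by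
      intro h
      apply Fin.ext
      simp [finProdFinEquiv]
      ring
    simp only [hf, e]
  have cs : (∑ t, f t) ^ 2 ≤ (m : ℝ) * ∑ t, f t ^ 2 := by
    simpa using sq_sum_le_card_mul_sum_sq (s := Finset.univ) (f := f)
  rw [← key] at cs
  have main : (m : ℝ) * (PAA w m q s - PAA w m c s) ^ 2 ≤ ∑ t, f t ^ 2 := by
    refine le_of_mul_le_mul_left ?_ hm0
    calc _ = ((m : ℝ) * (PAA w m q s - PAA w m c s)) ^ 2 := by ring
      _ ≤ _ := cs
  refine le_trans (mul_le_mul_of_nonneg_left ?_ hm0.le) main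
  split_ifs with ha hb
  · nlinarith
  · nlinarith
  · positivity
end

section
/- (Correctness of early termination when processing leaves in priority order.) Let n ≥ 1, let q be a point of EuclideanSpace ℝ (Fin n), let S be a nonempty finite set of points of EuclideanSpace ℝ (Fin n), and let C₁, …, C_m be subsets of S whose union is S, with lower bounds lb₁ ≤ lb₂ ≤ … ≤ lb_m satisfying lb_j ≤ dist q s for every s ∈ C_j. Let bsf₀ = dist q s₀ for some s₀ ∈ S, and define recursively bsf_j = min(bsf_{j−1}, min over s ∈ C_j of dist q s) (with bsf_j = bsf_{j−1} if C_j is empty). If for some k < m one has lb_{k+1} > bsf_k, then bsf_k equals the minimum over s ∈ S of dist q s: once the lower bound of the next leaf in nondecreasing-priority order exceeds the best-so-far value, all remaining leaves can be abandoned and the current best-so-far is the exact answer. -/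
theorem stmt12 (n : ℕ) (hn : 1 ≤ n) (q : EuclideanSpace ℝ (Fin n))
    (S : Finset (EuclideanSpace ℝ (Fin n))) (hS : S.Nonempty)
    (m : ℕ) (C : Fin m → Finset (EuclideanSpace ℝ (Fin n)))
    (hsub : ∀ j, C j ⊆ S)
    (hcover : ∀ s ∈ S, ∃ j, s ∈ C j)
    (lb : Fin m → ℝ) (hmono : Monotone lb)
    (hlb : ∀ j, ∀ s ∈ C j, lb j ≤ dist q s)
    (s₀ : EuclideanSpace ℝ (Fin n)) (hs₀ : s₀ ∈ S)
    (bsf : ℕ → ℝ) (hbsf0 : bsf 0 = dist q s₀)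
    (hrec : ∀ j : Fin m, bsf ((j : ℕ) + 1) =
      if h : (C j).Nonempty then min (bsf j) ((C j).inf' h (fun s => dist q s)) else bsf j)
    (k : ℕ) (hk : k < m) (hterm : bsf k < lb ⟨k, hk⟩) :
    bsf k = S.inf' hS (fun s => dist q s) := by
  have key : ∀ i : ℕ, i ≤ m → (∃ s ∈ S, bsf i = dist q s) ∧
      ∀ j : Fin m, (j : ℕ) < i → ∀ s ∈ C j, bsf i ≤ dist q s := by
    intro i
    induction i with
    | zero => exact fun _ => ⟨⟨s₀, hs₀, hbsf0⟩, fun j hj => absurd hj (Nat.not_lt_zero _)⟩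
    | succ i ih =>
      intro hi
      obtain ⟨⟨t, ht, hte⟩, hall⟩ := ih (by omega)
      have hr := hrec ⟨i, by omega⟩
      simp only at hr
      by_cases h : (C ⟨i, by omega⟩).Nonempty
      · rw [dif_pos h] at hr
        constructor
        · obtain ⟨u, hu, hue⟩ := Finset.exists_mem_eq_inf' h (fun s => dist q s)
          rcases min_choice (bsf i) ((C ⟨i, by omega⟩).inf' h (fun s => dist q s)) with h1 | h1
          · exact ⟨t, ht, by rw [hr, h1, hte]⟩
          · exact ⟨u, hsub _ hu, by rw [hr, h1, hue]⟩
        · intro j hj s hs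
          rw [hr]
          rcases Nat.lt_succ_iff_lt_or_eq.mp hj with h1 | h1
          · exact (min_le_left _ _).trans (hall j h1 s hs)
          · obtain rfl : j = ⟨i, hi⟩ := Fin.ext h1
            exact (min_le_right _ _).trans (Finset.inf'_le (fun s => dist q s) hs)
      · rw [dif_neg h] at hr
        rw [hr]
        refine ⟨⟨t, ht, hte⟩, fun j hj s hs => ?_⟩
        rcases Nat.lt_succ_iff_lt_or_eq.mp hj with h1 | h1
        · exact hall j h1 s hs
        · obtain rfl : j = ⟨i, hi⟩ := Fin.ext h1
          exact absurd ⟨s, hs⟩ h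
  obtain ⟨⟨t, ht, hte⟩, hall⟩ := key k hk.le
  apply le_antisymm
  · apply Finset.le_inf'
    intro s hs
    obtain ⟨j, hj⟩ := hcover s hs
    rcases lt_or_ge (j : ℕ) k with h | h
    · exact hall j h s hj
    · exact hterm.le.trans ((hmono (show (⟨k, hk⟩ : Fin m) ≤ j from h)).trans (hlb j s hj))
  · rw [hte]
    exact Finset.inf'_le (fun s => dist q s) ht
end

section
/- (Soundness of lower-bound pruning for k-NN search.) Let n ≥ 1, let q be a point of EuclideanSpace ℝ (Fin n), let S be a finite set of points of EuclideanSpace ℝ (Fin n), let C ⊆ S with a real lower bound lb satisfying lb ≤ dist q s for every s ∈ C, and let k ≥ 1. Suppose there exists T ⊆ S with |T| = k such that dist q t < lb for every t ∈ T. Then for every S' ⊆ S with |S'| = k such that max over t ∈ S' of dist q t ≤ min over u ∈ S ∖ S' of dist q u (i.e., S' is a set of k nearest neighbors of q in S), S' ∩ C = ∅: no series of a leaf whose lower bound exceeds the current k-th best distance can belong to the k-NN answer. -/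
open scoped Classical

theorem stmt13 (n : ℕ) (hn : 1 ≤ n) (q : EuclideanSpace ℝ (Fin n))
    (S : Finset (EuclideanSpace ℝ (Fin n)))
    (C : Finset (EuclideanSpace ℝ (Fin n))) (hC : C ⊆ S)
    (lb : ℝ) (hlb : ∀ s ∈ C, lb ≤ dist q s)
    (k : ℕ) (hk : 1 ≤ k)
    (T : Finset (EuclideanSpace ℝ (Fin n))) (hT : T ⊆ S) (hTcard : T.card = k)
    (hTd : ∀ t ∈ T, dist q t < lb) :
    ∀ S' : Finset (EuclideanSpace ℝ (Fin n)), S' ⊆ S → S'.card = k →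
      (∀ t ∈ S', ∀ u ∈ S \ S', dist q t ≤ dist q u) →
      S' ∩ C = ∅ := by
  intro S' hS' hcard hnn
  refine Finset.eq_empty_of_forall_notMem fun x hx => ?_
  obtain ⟨hx1, hx2⟩ := Finset.mem_inter.mp hx
  have hsub : T ⊆ S' := by
    intro t ht
    by_contra hn'
    have h1 := hnn x hx1 t (Finset.mem_sdiff.mpr ⟨hT ht, hn'⟩)
    have h2 := hTd t ht
    have h3 := hlb x hx2
    linarith
  have heq : T = S' := Finset.eq_of_subset_of_card_le hsub (by omega)
  have h4 := hTd x (heq ▸ hx1)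
  have h5 := hlb x hx2
  linarith
end

section
/- (PAA lower bound of LB_Keogh.) Let w, m ≥ 1, n = w·m, let q, c : Fin n → ℝ be series, r : ℕ a warping reach, and let U, L be the LB_Keogh envelope of q with reach r. For each segment s : Fin w, let d_s be the distance from PAA(c) s to the interval [PAA(L) s, PAA(U) s] (i.e., d_s = PAA(L) s − PAA(c) s if PAA(c) s < PAA(L) s, d_s = PAA(c) s − PAA(U) s if PAA(c) s > PAA(U) s, and d_s = 0 otherwise). Then sqrt(Σ_s m · d_s²) ≤ LB_Keogh_r(q,c): the distance computed between the candidate's PAA representation and the PAA representation of the query envelope lower bounds LB_Keogh. -/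
lemma seg_bound (m : ℕ) (hm : 1 ≤ m) (x g : Fin m → ℝ) (h : ∀ t, x t ≤ g t)
    (h0 : 0 ≤ ∑ t, x t) :
    (m : ℝ) * ((1 / (m : ℝ)) * ∑ t, x t) ^ 2 ≤ ∑ t, g t ^ 2 := by
  have hm' : (0 : ℝ) < m := by exact_mod_cast hm
  have h1 : ∑ t, x t ≤ ∑ t, g t := Finset.sum_le_sum fun t _ => h t
  have h2 : (∑ t, g t) ^ 2 ≤ (m : ℝ) * ∑ t, g t ^ 2 := by
    simpa using sq_sum_le_card_mul_sum_sq (s := (Finset.univ : Finset (Fin m))) (f := g)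
  have h3 : (∑ t, x t) ^ 2 ≤ (m : ℝ) * ∑ t, g t ^ 2 :=
    le_trans (pow_le_pow_left₀ h0 h1 2) h2
  have h4 : (m : ℝ) * ((1 / (m : ℝ)) * ∑ t, x t) ^ 2 = (∑ t, x t) ^ 2 / m := by
    field_simp
  rw [h4, div_le_iff₀ hm']
  linarith

lemma envL_le_envU {n : ℕ} (q : Fin n → ℝ) (r : ℕ) (i : Fin n) : envL q r i ≤ envU q r i := by
  have hi : i ∈ bandSet n r i := by simp [bandSet]
  exact le_trans (Finset.inf'_le q hi) (Finset.le_sup' q hi)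

theorem stmt14 (w m : ℕ) (hw : 1 ≤ w) (hm : 1 ≤ m) (q c : Fin (w * m) → ℝ) (r : ℕ)
    (d : Fin w → ℝ)
    (hd : ∀ s, d s =
      if PAA w m c s < PAA w m (envL q r) s then PAA w m (envL q r) s - PAA w m c s
      else if PAA w m (envU q r) s < PAA w m c s then PAA w m c s - PAA w m (envU q r) s
      else 0) :
    Real.sqrt (∑ s : Fin w, (m : ℝ) * d s ^ 2) ≤ LBKeogh q c r := by
  unfold LBKeogh
  apply Real.sqrt_le_sqrt
  set g : Fin (w * m) → ℝ := fun i => max (c i - envU q r i) (max (envL q r i - c i) 0) with hg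
  have hsum : (∑ i, if envU q r i < c i then (c i - envU q r i) ^ 2
      else if c i < envL q r i then (c i - envL q r i) ^ 2 else 0) = ∑ i, g i ^ 2 := by
    refine Finset.sum_congr rfl fun i _ => ?_
    have hLU := envL_le_envU q r i
    simp only [hg]
    split_ifs with h1 h2
    · rw [max_eq_left]
      exact max_le (by linarith) (by linarith)
    · rw [max_eq_left (a := envL q r i - c i) (by linarith), max_eq_right (by linarith)]
      ring
    · rw [max_eq_right (a := envL q r i - c i) (by linarith), max_eq_right (by linarith)]
      ring
  rw [hsum, ← (finProdFinEquiv (m := w) (n := m)).sum_comp, Fintype.sum_prod_type]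
  refine Finset.sum_le_sum fun s _ => ?_
  have key : ∀ f : Fin (w * m) → ℝ,
      PAA w m f s = (1 / (m : ℝ)) * ∑ t : Fin m, f (finProdFinEquiv (s, t)) := by
    intro f
    unfold PAA
    congr 1
    refine Finset.sum_congr rfl fun t _ => ?_
    congr 1
    apply Fin.ext
    simp [finProdFinEquiv]
    ring
  have hm' : (0 : ℝ) < 1 / (m : ℝ) := by
    have : (0 : ℝ) < m := by exact_mod_cast hm
    positivity
  rw [hd s]
  simp only [key]
  split_ifs with h1 h2
  · rw [← mul_sub, ← Finset.sum_sub_distrib]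
    refine seg_bound m hm _ _ (fun t => ?_) ?_
    · exact le_trans (le_max_left _ _) (le_max_right _ _)
    · rw [Finset.sum_sub_distrib]
      have := lt_of_mul_lt_mul_left h1 hm'.le
      linarith
  · rw [← mul_sub, ← Finset.sum_sub_distrib]
    refine seg_bound m hm _ _ (fun t => ?_) ?_
    · exact le_max_left _ _
    · rw [Finset.sum_sub_distrib]
      have := lt_of_mul_lt_mul_left h2 hm'.le
      linarith
  · have : 0 ≤ ∑ t : Fin m, g (finProdFinEquiv (s, t)) ^ 2 :=
      Finset.sum_nonneg fun t _ => sq_nonneg _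
    simpa using this
end
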